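/- arXiv:1803.11245 — 9 statements merged into one kernel-verified Lean document; each statement's English description precedes it below -/
import Mathlib

section
/- Let w ≥ 1 and let E' be a set of strings over Σ each of length exactly w. Let d be a string such that exactly one proper prefix of d belongs to E', exactly one proper suffix of d belongs to E', and every occurrence of an element of E' as a contiguous substring of d starts either at position 0 of d or at position |d| − w. If s is a suffix of d with |s| > w, then the length-w suffix of s belongs to E', and every occurrence of an element of E' as a contiguous substring of s starts either at position 0 of s (which is possible only when s = d) or at position |s| − w of s. -/
/-- An occurrence of `e` as a contiguous substring of `d` at position `p`. -/
def Occ {σ : Type*} (e d : List σ) (p : ℕ) : Prop :=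
  p + e.length ≤ d.length ∧ e = (d.drop p).take e.length

/-- properties of long suffixes of a phrase `d` delimited by
elements of `E'`. -/
theorem stmt_1 {σ : Type*} [LinearOrder σ] (w : ℕ) (hw : 1 ≤ w)
    (E' : Set (List σ)) (hlen : ∀ e ∈ E', e.length = w)
    (d : List σ)
    (hpre : ∃! u, (u <+: d ∧ u ≠ d) ∧ u ∈ E')
    (hsuf : ∃! u, (u <:+ d ∧ u ≠ d) ∧ u ∈ E')
    (hocc : ∀ e ∈ E', ∀ p, Occ e d p → p = 0 ∨ p = d.length - w)
    (s : List σ) (hs : s <:+ d) (hslen : w < s.length) :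
    s.drop (s.length - w) ∈ E' ∧
    ∀ e ∈ E', ∀ p, Occ e s p → (p = 0 ∧ s = d) ∨ p = s.length - w := by
  obtain ⟨u, ⟨⟨hu, -⟩, huE⟩, -⟩ := hsuf
  have hul := hlen u huE
  obtain ⟨t, rfl⟩ := hs
  refine ⟨?_, ?_⟩
  · have h1 : u <:+ s :=
      List.suffix_of_suffix_length_le hu (List.suffix_append t s) (by omega)
    obtain ⟨v, rfl⟩ := h1
    have : (v ++ u).length - w = v.length := by simp [hul]
    rw [this]
    simpa using huE
  · rintro e he p ⟨h1, h2⟩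
    have h3 : Occ e (t ++ s) (t.length + p) := by
      refine ⟨by simp only [List.length_append]; omega, ?_⟩
      rw [← List.drop_drop, List.drop_left]
      exact h2
    rcases hocc e he _ h3 with h | h
    · left
      have ht : t = [] := List.length_eq_zero_iff.mp (by omega)
      subst ht
      exact ⟨by omega, rfl⟩
    · right
      simp only [List.length_append] at h
      omega
end

section
/- Let w ≥ 1, let E' be a set of strings over Σ each of length exactly w, and let W be a string over Σ. Define D(W) as the set of strings d such that d occurs as a contiguous substring of W, exactly one proper prefix of d belongs to E', exactly one proper suffix of d belongs to E', and every occurrence of an element of E' as a contiguous substring of d starts either at position 0 of d or at position |d| − w. Define S(W) as the set of strings s of length greater than w that are suffixes of some element of D(W). Then S(W) is prefix-free: no element of S(W) is a proper prefix of another element of S(W). -/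
/-- `d` belongs to the dictionary `D(W)` determined by the trigger set `E'`
and window size `w`. -/
def InD {σ : Type*} (w : ℕ) (E' : Set (List σ)) (W d : List σ) : Prop :=
  (∃ p, Occ d W p) ∧
  (∃! u, (u <+: d ∧ u ≠ d) ∧ u ∈ E') ∧
  (∃! u, (u <:+ d ∧ u ≠ d) ∧ u ∈ E') ∧
  (∀ e ∈ E', ∀ p, Occ e d p → p = 0 ∨ p = d.length - w)

/-- `s` belongs to `S(W)`: suffixes of dictionary phrases of length `> w`. -/
def InS {σ : Type*} (w : ℕ) (E' : Set (List σ)) (W s : List σ) : Prop :=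
  w < s.length ∧ ∃ d, InD w E' W d ∧ s <:+ d

/-- the set `S(W)` is prefix-free. -/
theorem stmt_2 {σ : Type*} [LinearOrder σ] (w : ℕ) (hw : 1 ≤ w)
    (E' : Set (List σ)) (hlen : ∀ e ∈ E', e.length = w) (W : List σ) :
    ∀ s, InS w E' W s → ∀ s', InS w E' W s' → s <+: s' → s = s' := by
  rintro s ⟨hs, d, ⟨_, _, ⟨e, ⟨⟨he, _⟩, heE⟩, _⟩, _⟩, hsd⟩ s' ⟨_, d', ⟨_, _, _, hocc⟩, c, hc⟩ ⟨b, hb⟩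
  have hew := hlen e heE
  obtain ⟨a, rfl⟩ : e <:+ s := List.suffix_of_suffix_length_le he hsd (by omega)
  subst hb
  subst hc
  have h := hocc e heE (c.length + a.length) (by
    refine ⟨by simp; omega, ?_⟩
    have : c ++ (a ++ e ++ b) = (c ++ a) ++ (e ++ b) := by simp
    rw [this, ← List.length_append, List.drop_left, List.take_left])
  simp only [List.length_append] at h hs
  have hb : b.length = 0 := by omega
  rw [List.length_eq_zero_iff] at hb
  simp [hb]
end

section
/- Let w ≥ 1, let E' be a set of strings over Σ each of length exactly w, and let W be a string over Σ. Define D(W) as the set of strings d such that d occurs as a contiguous substring of W, exactly one proper prefix of d belongs to E', exactly one proper suffix of d belongs to E', and every occurrence of an element of E' as a contiguous substring of d starts either at position 0 of d or at position |d| − w. Suppose some element of E' occurs as a contiguous substring of W at position i, some element of E' occurs at position j with i < j, and no element of E' occurs in W at any position p with i < p < j. Then the factor of W of length j − i + w starting at position i belongs to D(W). -/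
/-- the factor of `W` stretching from one occurrence of an element
of `E'` to the next one belongs to the dictionary `D(W)`. -/
theorem stmt_3 {σ : Type*} [LinearOrder σ] (w : ℕ) (hw : 1 ≤ w)
    (E' : Set (List σ)) (hlen : ∀ e ∈ E', e.length = w) (W : List σ)
    (e e' : List σ) (he : e ∈ E') (he' : e' ∈ E')
    (i j : ℕ) (hij : i < j) (hi : Occ e W i) (hj : Occ e' W j)
    (hmid : ∀ p, i < p → p < j → ∀ e'' ∈ E', ¬ Occ e'' W p) :
    InD w E' W ((W.drop i).take (j - i + w)) := by
  obtain ⟨hi1, hi2⟩ := hi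
  obtain ⟨hj1, hj2⟩ := hj
  have le := hlen e he
  have le' := hlen e' he'
  rw [le] at hi1 hi2
  rw [le'] at hj1 hj2
  have hL : ((W.drop i).take (j - i + w)).length = j - i + w := by
    simp only [List.length_take, List.length_drop]; omega
  have hpre : e <+: (W.drop i).take (j - i + w) := by
    rw [hi2]
    exact List.take_prefix_take_left (by omega)
  have hsuf : e' <:+ (W.drop i).take (j - i + w) := by
    have : e' = ((W.drop i).take (j - i + w)).drop (j - i) := by
      rw [List.drop_take, List.drop_drop, hj2]
      congr 2 <;> omega
    rw [this]
    exact List.drop_suffix _ _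
  refine ⟨⟨i, ?_, ?_⟩, ⟨e, ⟨⟨hpre, ?_⟩, he⟩, ?_⟩, ⟨e', ⟨⟨hsuf, ?_⟩, he'⟩, ?_⟩, ?_⟩
  · rw [hL]; omega
  · rw [hL]
  · intro h
    have := congrArg List.length h
    omega
  · rintro u ⟨⟨hu, -⟩, huE⟩
    exact (List.prefix_of_prefix_length_le hu hpre (by rw [hlen u huE, le])).eq_of_length (by rw [hlen u huE, le])
  · intro h
    have := congrArg List.length h
    omega
  · rintro u ⟨⟨hu, -⟩, huE⟩
    exact (List.suffix_of_suffix_length_le hu hsuf (by rw [hlen u huE, le'])).eq_of_length (by rw [hlen u huE, le'])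
  · rintro f hf p ⟨h1, h2⟩
    have lf := hlen f hf
    rw [lf] at h2
    rw [hL, lf] at h1
    rw [hL]
    by_contra hcon
    push Not at hcon
    refine hmid (i + p) (by omega) (by omega) f hf ⟨by omega, ?_⟩
    rw [lf, h2, List.drop_take, List.drop_drop, List.take_take]
    congr 1
    omega
end

section
/- Let w ≥ 1, let E' be a set of strings over Σ each of length exactly w, and let W be a string over Σ whose length-w prefix belongs to E' and whose length-w suffix belongs to E'. Define D(W) as the set of strings d such that d occurs as a contiguous substring of W, exactly one proper prefix of d belongs to E', exactly one proper suffix of d belongs to E', and every occurrence of an element of E' as a contiguous substring of d starts either at position 0 of d or at position |d| − w. Define S(W) as the set of strings s of length greater than w that are suffixes of some element of D(W). Then for every suffix x of W with |x| > w, exactly one prefix s of x belongs to S(W). -/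
theorem InS_facts {σ : Type*} (w : ℕ)
    (E' : Set (List σ)) (hlen : ∀ e ∈ E', e.length = w) (W s : List σ)
    (h : InS w E' W s) : w < s.length ∧ s.drop (s.length - w) ∈ E' ∧
      ∀ q, 0 < q → q + w ≤ s.length → (s.drop q).take w ∈ E' → q = s.length - w := by
  obtain ⟨hl, d, ⟨-, -, ⟨u, ⟨⟨hu, -⟩, huE⟩, -⟩, hocc⟩, t, rfl⟩ := h
  refine ⟨hl, ?_, ?_⟩
  · have hul := hlen u huE
    have h1 : u <:+ s := List.suffix_of_suffix_length_le hu (List.suffix_append t s) (by omega)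
    rw [List.suffix_iff_eq_drop] at h1
    rw [← hul, ← h1]; exact huE
  · intro q hq hqw hE
    have hel := hlen _ hE
    have := hocc _ hE (t.length + q) ⟨by rw [hel, List.length_append]; omega, by
      rw [hel, List.drop_append, List.drop_eq_nil_of_le (as := t) (i := t.length + q) (by omega)]; simp⟩
    simp only [List.length_append] at this
    omega

theorem InS_le {σ : Type*} (w : ℕ)
    (E' : Set (List σ)) (hlen : ∀ e ∈ E', e.length = w) (W x s t : List σ)
    (hs : InS w E' W s) (ht : InS w E' W t) (hsx : s <+: x) (htx : t <+: x)
    (hle : s.length ≤ t.length) : s = t := by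
  obtain ⟨a1, a2, -⟩ := InS_facts w E' hlen W s hs
  obtain ⟨b1, -, b3⟩ := InS_facts w E' hlen W t ht
  have hst : s <+: t := List.prefix_of_prefix_length_le hsx htx hle
  obtain ⟨r, rfl⟩ := hst
  have := b3 (s.length - w) (by omega) (by omega) (by
    rw [List.drop_append_of_le_length (by omega), List.take_left' (by simp; omega)]
    exact a2)
  simp only [List.length_append] at this
  have : r = [] := List.eq_nil_of_length_eq_zero (by omega)
  simp [this]

/-- every suffix of `W` of length `> w` has exactly one prefix
in `S(W)`. -/
theorem stmt_4 {σ : Type*} [LinearOrder σ] (w : ℕ) (hw : 1 ≤ w)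
    (E' : Set (List σ)) (hlen : ∀ e ∈ E', e.length = w) (W : List σ)
    (hWpre : W.take w ∈ E') (hWsuf : W.drop (W.length - w) ∈ E') :
    ∀ x, x <:+ W → w < x.length → ∃! s, s <+: x ∧ InS w E' W s := by
  classical
  intro x hx hxl
  apply existsUnique_of_exists_of_unique
  swap
  · rintro s t ⟨hsx, hs⟩ ⟨htx, ht⟩
    rcases le_total s.length t.length with h | h
    · exact InS_le w E' hlen W x s t hs ht hsx htx h
    · exact (InS_le w E' hlen W x t s ht hs htx hsx h).symm
  rw [List.suffix_iff_eq_drop] at hx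
  obtain ⟨k, hk⟩ : ∃ k, k = W.length - x.length := ⟨_, rfl⟩
  rw [← hk] at hx
  subst hx
  have hkw : k + w < W.length := by
    simp only [List.length_drop] at hxl; omega
  clear hk hxl
  let T : ℕ → Prop := fun p => (W.drop p).take w ∈ E'
  have hT0 : T 0 := by simpa [T] using hWpre
  have hTn : ∃ j, k < j ∧ j + w ≤ W.length ∧ T j :=
    ⟨W.length - w, by omega, by omega, by
      show (W.drop (W.length - w)).take w ∈ E'
      rw [List.take_of_length_le (by simp; omega)]; exact hWsuf⟩
  have hi : T (Nat.findGreatest T k) := Nat.findGreatest_spec (Nat.zero_le k) hT0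
  have hik : Nat.findGreatest T k ≤ k := Nat.findGreatest_le k
  have himax : ∀ p, p ≤ k → T p → p ≤ Nat.findGreatest T k :=
    fun p hp h => Nat.le_findGreatest hp h
  obtain ⟨hkj, hjn, hTj⟩ := Nat.find_spec hTn
  have hjmin : ∀ p, k < p → p + w ≤ W.length → T p → Nat.find hTn ≤ p :=
    fun p h1 h2 h3 => Nat.find_min' hTn ⟨h1, h2, h3⟩
  generalize Nat.findGreatest T k = i at *
  generalize Nat.find hTn = j at *
  have hdl : ((W.drop i).take (j + w - i)).length = j + w - i := by simp; omega
  refine ⟨(W.drop k).take (j + w - k), List.take_prefix _ _, by simp; omega,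
    (W.drop i).take (j + w - i), ⟨⟨i, by omega, by rw [hdl]⟩, ?_, ?_, ?_⟩, ?_⟩
  · refine ⟨(W.drop i).take w, ⟨⟨List.take_prefix_take_left (by omega), ?_⟩, hi⟩, ?_⟩
    · intro h
      have := congrArg List.length h
      rw [hdl, hlen _ hi] at this; omega
    · rintro u ⟨⟨hu, -⟩, huE⟩
      have h2 := hu.trans (List.take_prefix _ _)
      rw [List.prefix_iff_eq_take, hlen u huE] at h2
      exact h2
  · have key : ((W.drop i).take (j + w - i)).drop (j - i) = (W.drop j).take w := by
      rw [List.drop_take, List.drop_drop]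
      congr 1
      · omega
      · congr 1; omega
    refine ⟨(W.drop j).take w, ⟨⟨key ▸ List.drop_suffix _ _, ?_⟩, hTj⟩, ?_⟩
    · intro h
      have := congrArg List.length h
      rw [hdl, hlen _ hTj] at this; omega
    · rintro u ⟨⟨hu, -⟩, huE⟩
      rw [List.suffix_iff_eq_drop, hlen u huE, hdl] at hu
      rw [hu, ← key]; congr 1; omega
  · rintro e he p ⟨h1, h2⟩
    rw [hlen e he, hdl] at h1
    rw [hdl]
    have hTp : T (i + p) := by
      show (W.drop (i + p)).take w ∈ E'
      rw [hlen e he, List.drop_take, List.drop_drop, List.take_take, min_eq_left (by omega)] at h2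
      rw [← h2]; exact he
    rcases le_or_gt (i + p) k with h | h
    · have := himax _ h hTp; omega
    · have := hjmin _ h (by omega) hTp; omega
  · have key : ((W.drop i).take (j + w - i)).drop (k - i) = (W.drop k).take (j + w - k) := by
      rw [List.drop_take, List.drop_drop]
      congr 1
      · omega
      · congr 1; omega
    rw [← key]; exact List.drop_suffix _ _
end

section
/- Let w ≥ 1, let E' be a set of strings over Σ each of length exactly w, and let W be a string over Σ whose length-w prefix belongs to E' and whose length-w suffix belongs to E'. Define D(W) as the set of strings d such that d occurs as a contiguous substring of W, exactly one proper prefix of d belongs to E', exactly one proper suffix of d belongs to E', and every occurrence of an element of E' as a contiguous substring of d starts either at position 0 of d or at position |d| − w. Define S(W) as the set of strings s of length greater than w that are suffixes of some element of D(W). Let x and x' be suffixes of W with |x|, |x'| > w, let s ∈ S(W) be a prefix of x and s' ∈ S(W) be a prefix of x'. If s is strictly lexicographically smaller than s', then x is strictly lexicographically smaller than x'. -/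
theorem lex_aux {σ : Type*} [LinearOrder σ] {a b : List σ} (h : List.Lex (· < ·) a b) :
    (∃ t, t ≠ [] ∧ b = a ++ t) ∨ ∀ c d, List.Lex (· < ·) (a ++ c) (b ++ d) := by
  induction h with
  | nil => exact Or.inl ⟨_, List.cons_ne_nil _ _, rfl⟩
  | rel h => exact Or.inr fun c d => List.Lex.rel h
  | cons h ih =>
    rcases ih with ⟨t, ht, rfl⟩ | ih
    · exact Or.inl ⟨t, ht, rfl⟩
    · exact Or.inr fun c d => List.Lex.cons (ih c d)

/-- comparing the `S(W)`-prefixes of two long suffixes of `W`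
determines the lexicographic order of the suffixes themselves. -/
theorem stmt_5 {σ : Type*} [LinearOrder σ] (w : ℕ) (hw : 1 ≤ w)
    (E' : Set (List σ)) (hlen : ∀ e ∈ E', e.length = w) (W : List σ)
    (hWpre : W.take w ∈ E') (hWsuf : W.drop (W.length - w) ∈ E')
    (x x' : List σ) (hx : x <:+ W) (hx' : x' <:+ W)
    (hxlen : w < x.length) (hx'len : w < x'.length)
    (s s' : List σ) (hsS : InS w E' W s) (hs'S : InS w E' W s')
    (hsx : s <+: x) (hs'x' : s' <+: x')
    (hss' : List.Lex (· < ·) s s') :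
    List.Lex (· < ·) x x' := by
  obtain ⟨c, rfl⟩ := hsx
  obtain ⟨c', rfl⟩ := hs'x'
  rcases lex_aux hss' with ⟨t, ht, rfl⟩ | h
  · exfalso
    obtain ⟨hsl, d, ⟨-, -, ⟨u, ⟨⟨hu, -⟩, huE⟩, -⟩, -⟩, hsd⟩ := hsS
    obtain ⟨-, d', ⟨-, -, -, hocc⟩, q, rfl⟩ := hs'S
    have hul := hlen u huE
    obtain ⟨p, rfl⟩ := List.suffix_of_suffix_length_le hu hsd (by omega)
    have htl : 0 < t.length := List.length_pos_iff.2 ht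
    have h := hocc u huE (q ++ p).length ⟨by simp; omega, by
      have : q ++ (p ++ u ++ t) = (q ++ p) ++ (u ++ t) := by simp
      rw [this, List.drop_left, List.take_left]⟩
    simp only [List.length_append] at h hsl
    omega
  · exact h c c'
end

section
/- Let w ≥ 1, let T be a string of length n over Σ, and let # and $ be distinct symbols with # < $ and with both # and $ strictly smaller than every character occurring in T. For 0 ≤ i ≤ n − 1 define A_i = (drop i T) ++ ($ repeated w times), define A_n = [#] ++ T ++ ($ repeated w times), and for 0 ≤ i ≤ n define B_i = drop i (T ++ [$]). Then for all 0 ≤ i, j ≤ n: A_i is strictly lexicographically smaller than A_j if and only if B_i is strictly lexicographically smaller than B_j. (In other words, the permutation that lexicographically sorts T[0..n−1]$^w, …, T[n−1]$^w, #T$^w also lexicographically sorts the suffixes of T$.) -/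
theorem aux_cons {σ : Type*} [LinearOrder σ] (a b : σ) (U V : List σ) :
    List.Lex (· < ·) (a :: U) (b :: V) ↔ a < b ∨ (a = b ∧ List.Lex (· < ·) U V) := by
  constructor
  · intro h
    cases h with
    | cons h => exact Or.inr ⟨rfl, h⟩
    | rel h => exact Or.inl h
  · rintro (h | ⟨rfl, h⟩)
    · exact List.Lex.rel h
    · exact List.Lex.cons h

theorem aux_irrefl {σ : Type*} [LinearOrder σ] (U : List σ) :
    ¬ List.Lex (· < ·) U U := by
  induction U with
  | nil => intro h; cases h
  | cons a U ih => rw [aux_cons]; simp [ih]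

theorem aux_main {σ : Type*} [LinearOrder σ] (d : σ) (k : ℕ) (U V : List σ)
    (hU : ∀ c ∈ U, d < c) (hV : ∀ c ∈ V, d < c) :
    List.Lex (· < ·) (U ++ List.replicate (k + 1) d) (V ++ List.replicate (k + 1) d) ↔
      List.Lex (· < ·) (U ++ [d]) (V ++ [d]) := by
  induction U generalizing V with
  | nil =>
    cases V with
    | nil => simp only [List.nil_append, aux_irrefl]
    | cons v V =>
      have := hV v (by simp)
      simp only [List.nil_append, List.cons_append, List.replicate_succ, aux_cons, this, true_or]
  | cons u U ih =>
    have hu := hU u (by simp)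
    cases V with
    | nil =>
      simp only [List.nil_append, List.cons_append, List.replicate_succ, aux_cons, hu.not_gt,
        hu.ne', false_and, or_false]
    | cons v V =>
      simp only [List.cons_append, aux_cons]
      rw [ih V (fun c hc => hU c (by simp [hc])) (fun c hc => hV c (by simp [hc]))]

/-- the permutation sorting `T[0..n-1]$^w, …, T[n-1]$^w, #T$^w`
also sorts the suffixes of `T$`. -/
theorem stmt_7 {σ : Type*} [LinearOrder σ] (w : ℕ) (hw : 1 ≤ w)
    (T : List σ) (n : ℕ) (hn : T.length = n)
    (hash dollar : σ) (hhd : hash < dollar)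
    (hsmall : ∀ c ∈ T, hash < c ∧ dollar < c)
    (A B : ℕ → List σ)
    (hA : ∀ i < n, A i = T.drop i ++ List.replicate w dollar)
    (hAn : A n = hash :: (T ++ List.replicate w dollar))
    (hB : ∀ i ≤ n, B i = (T ++ [dollar]).drop i) :
    ∀ i ≤ n, ∀ j ≤ n,
      (List.Lex (· < ·) (A i) (A j) ↔ List.Lex (· < ·) (B i) (B j)) := by
  obtain ⟨k, rfl⟩ : ∃ k, w = k + 1 := ⟨w - 1, by omega⟩
  subst hn
  have hd : ∀ i, ∀ c ∈ T.drop i, hash < c ∧ dollar < c :=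
    fun i c hc => hsmall c (List.mem_of_mem_drop hc)
  have hB' : ∀ i ≤ T.length, B i = T.drop i ++ [dollar] := fun i hi => by
    rw [hB i hi, List.drop_append_of_le_length hi]
  have hne : ∀ i < T.length, ∃ c U, T.drop i = c :: U ∧ hash < c ∧ dollar < c := by
    intro i hi
    exact ⟨T[i], T.drop (i + 1), List.drop_eq_getElem_cons hi, hsmall _ (List.getElem_mem hi)⟩
  intro i hi j hj
  rw [hB' i hi, hB' j hj]
  rcases hi.lt_or_eq with hi' | rfl
  · rcases hj.lt_or_eq with hj' | rfl
    · rw [hA i hi', hA j hj']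
      exact aux_main dollar k _ _ (fun c hc => (hd i c hc).2) (fun c hc => (hd j c hc).2)
    · obtain ⟨c, U, h, h1, h2⟩ := hne i hi'
      rw [hA i hi', hAn, h, List.drop_length]
      simp only [List.nil_append, List.cons_append, aux_cons, h1.not_gt, h1.ne', h2.not_gt,
        h2.ne', false_and, or_false]
  · rcases hj.lt_or_eq with hj' | rfl
    · obtain ⟨c, U, h, h1, h2⟩ := hne j hj'
      rw [hA j hj', hAn, h, List.drop_length]
      simp only [List.nil_append, List.cons_append, aux_cons, h1, h2, true_or]
    · simp only [aux_irrefl]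
end

section
/- Let w ≥ 1, let T be a string of length n over Σ, and let # and $ be distinct symbols with # < $ and with both # and $ strictly smaller than every character occurring in T. Set T' = T ++ [$] and W = [#] ++ T ++ ($ repeated w times). For 0 ≤ i ≤ n define y_i = drop i T', define G(i) = drop (i+1) W for 0 ≤ i ≤ n − 1 and G(n) = W, and define pred(i) = T'[i−1] for 1 ≤ i ≤ n and pred(0) = $ (the character cyclically preceding the suffix y_i in T', i.e., the BWT character associated with y_i). Let S be a set of strings over Σ such that no element of S is a proper prefix of another element of S, and assume every G(i) (0 ≤ i ≤ n) has some prefix belonging to S. Let s ∈ S, let a be a character, and let t and k be natural numbers such that: t is the number of indices i ∈ {0,…,n} for which some element of S that is strictly lexicographically smaller than s is a prefix of G(i); k is the number of indices i ∈ {0,…,n} for which s is a prefix of G(i); and pred(i) = a for every index i with s a prefix of G(i). Then for every index i ∈ {0,…,n} such that the number of indices j ∈ {0,…,n} with y_j strictly lexicographically smaller than y_i is at least t and less than t + k, we have pred(i) = a. (That is, the (t+1)st through (t+k)th characters of the BWT of T' are all copies of a.) -/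
theorem lex_ext {σ : Type*} [LinearOrder σ] (u v x z : List σ) (h : u < v)
    (hp : ¬ u <+: v) : u ++ x < v ++ z := by
  induction u generalizing v with
  | nil => exact absurd List.nil_prefix hp
  | cons c u ih =>
    cases v with
    | nil => simp at h
    | cons d v =>
      simp only [List.cons_append, List.cons_lt_cons_iff] at h ⊢
      rcases h with h | ⟨rfl, h⟩
      · exact Or.inl h
      · refine Or.inr ⟨rfl, ih v h ?_⟩
        intro hh
        exact hp (by simpa using hh)

theorem no_pref {σ : Type*} (A B : List σ) (d : σ) (hA : d ∉ B)
    (h : A ++ [d] <+: B ++ [d]) : A ++ [d] = B ++ [d] := by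
  obtain ⟨r, hr⟩ := h
  rcases List.eq_nil_or_concat r with rfl | ⟨r', z, rfl⟩
  · simpa using hr
  · exfalso
    have h2 : (A ++ [d] ++ r') ++ [z] = B ++ [d] := by simpa using hr
    have h3 := List.append_inj_left' h2 rfl
    apply hA
    rw [← h3]
    simp

/-- if `β` maps `k` copies of `a` (and nothing else) to `s ∈ S`,
and a total of `t` characters to elements of `S` lexicographically smaller than
`s`, then the `(t+1)`st through `(t+k)`th characters of the BWT of `T' = T$`
are copies of `a`. -/
theorem stmt_9 {σ : Type*} [LinearOrder σ] (w : ℕ) (hw : 1 ≤ w)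
    (T : List σ) (n : ℕ) (hn : T.length = n)
    (hash dollar : σ) (hhd : hash < dollar)
    (hsmall : ∀ c ∈ T, hash < c ∧ dollar < c)
    (T' W : List σ) (hT' : T' = T ++ [dollar])
    (hW : W = hash :: (T ++ List.replicate w dollar))
    (y G : ℕ → List σ) (pred : ℕ → σ)
    (hy : ∀ i ≤ n, y i = T'.drop i)
    (hG : ∀ i < n, G i = W.drop (i + 1)) (hGn : G n = W)
    (hpred0 : pred 0 = dollar)
    (hpredi : ∀ i, 1 ≤ i → i ≤ n → pred i = T'.getD (i - 1) dollar)
    (S : Set (List σ)) (hpf : ∀ u ∈ S, ∀ v ∈ S, u <+: v → u = v)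
    (hcover : ∀ i ≤ n, ∃ s ∈ S, s <+: G i)
    (s : List σ) (hs : s ∈ S) (a : σ) (t k : ℕ)
    (ht : t = {i | i ≤ n ∧ ∃ s' ∈ S, List.Lex (· < ·) s' s ∧ s' <+: G i}.ncard)
    (hk : k = {i | i ≤ n ∧ s <+: G i}.ncard)
    (ha : ∀ i ≤ n, s <+: G i → pred i = a) :
    ∀ i ≤ n,
      t ≤ {j | j ≤ n ∧ List.Lex (· < ·) (y j) (y i)}.ncard →
      {j | j ≤ n ∧ List.Lex (· < ·) (y j) (y i)}.ncard < t + k →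
      pred i = a := by
  change ∀ i ≤ n, t ≤ {j | j ≤ n ∧ y j < y i}.ncard →
    {j | j ≤ n ∧ y j < y i}.ncard < t + k → pred i = a
  change t = {i | i ≤ n ∧ ∃ s' ∈ S, s' < s ∧ s' <+: G i}.ncard at ht
  have hdT : dollar ∉ T := fun h => lt_irrefl _ (hsmall _ h).2
  have hy1 : ∀ i ≤ n, y i = T.drop i ++ [dollar] := by
    intro i hi
    rw [hy i hi, hT', List.drop_append_of_le_length (by omega)]
  have hG1 : ∀ i < n, G i = y i ++ List.replicate (w-1) dollar := by
    intro i hi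
    rw [hG i hi, hW, List.drop_succ_cons, List.drop_append_of_le_length (by omega), hy1 i hi.le]
    obtain ⟨v, rfl⟩ : ∃ v, w = v + 1 := ⟨w - 1, by omega⟩
    simp [List.replicate_succ]
  have hhead : ∀ i < n, ∃ c ∈ T, ∃ r, T.drop i = c :: r := by
    intro i hi
    have hi' : i < T.length := by omega
    exact ⟨T[i], List.getElem_mem hi', _, List.drop_eq_getElem_cons hi'⟩
  have key2 : ∀ i ≤ n, ∀ j ≤ n, y i < y j → G i < G j := by
    intro i hi j hj hij
    rcases hj.eq_or_lt with rfl | hj'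
    · exfalso
      rcases hi.eq_or_lt with rfl | hi'
      · exact lt_irrefl _ hij
      · obtain ⟨c, hc, r, hr⟩ := hhead i hi'
        rw [hy1 _ hi, hy1 _ hj, hr, List.drop_eq_nil_of_le (by omega)] at hij
        simp only [List.cons_append, List.nil_append, List.cons_lt_cons_iff] at hij
        have := (hsmall c hc).2
        rcases hij with h | ⟨h, _⟩
        · exact lt_asymm h this
        · exact this.ne h.symm
    · rcases hi.eq_or_lt with rfl | hi'
      · obtain ⟨c, hc, r, hr⟩ := hhead j hj'
        rw [hGn, hW, hG1 j hj', hy1 j hj, hr]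
        simp only [List.cons_append, List.cons_lt_cons_iff]
        exact Or.inl (hsmall c hc).1
      · rw [hG1 i hi', hG1 j hj']
        apply lex_ext _ _ _ _ hij
        intro hp
        rw [hy1 i hi, hy1 j hj] at hp
        have := no_pref _ _ _ (fun h => hdT (List.mem_of_mem_drop h)) hp
        rw [← hy1 i hi, ← hy1 j hj] at this
        exact hij.ne this
  have hinj : ∀ i ≤ n, ∀ j ≤ n, y i = y j → i = j := by
    intro i hi j hj h
    rw [hy1 i hi, hy1 j hj] at h
    have := congrArg List.length h
    simp at this
    omega
  have huniq : ∀ i, ∀ u ∈ S, ∀ v ∈ S, u <+: G i → v <+: G i → u = v := by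
    intro i u hu v hv h1 h2
    rcases List.prefix_or_prefix_of_prefix h1 h2 with h | h
    · exact hpf u hu v hv h
    · exact (hpf v hv u hu h).symm
  have key : ∀ i ≤ n, ∀ j ≤ n, ∀ u ∈ S, ∀ v ∈ S, u <+: G i → v <+: G j → u < v → y i < y j := by
    intro i hi j hj u hu v hv h1 h2 huv
    have hGG : G i < G j := by
      obtain ⟨x, hx⟩ := h1
      obtain ⟨z, hz⟩ := h2
      rw [← hx, ← hz]
      exact lex_ext _ _ _ _ huv (fun hp => huv.ne (hpf u hu v hv hp))
    rcases lt_trichotomy (y i) (y j) with h | h | h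
    · exact h
    · have := hinj i hi j hj h
      subst this
      exact absurd hGG (lt_irrefl _)
    · exact absurd (key2 j hj i hi h) (lt_asymm hGG)
  have hfin : ∀ P : ℕ → Prop, {i | i ≤ n ∧ P i}.Finite := fun P =>
    (Set.finite_Iic n).subset (fun i hi => hi.1)
  intro i hi h1 h2
  obtain ⟨u, hu, hui⟩ := hcover i hi
  rcases lt_trichotomy u s with h | h | h
  · exfalso
    have hsub : {j | j ≤ n ∧ y j < y i} ⊂ {i | i ≤ n ∧ ∃ s' ∈ S, s' < s ∧ s' <+: G i} := by
      rw [Set.ssubset_iff_of_subset]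
      · exact ⟨i, ⟨hi, u, hu, h, hui⟩, fun hh => lt_irrefl _ hh.2⟩
      · rintro j ⟨hj, hji⟩
        obtain ⟨v, hv, hvj⟩ := hcover j hj
        refine ⟨hj, v, hv, lt_of_not_ge (fun hsv => ?_), hvj⟩
        exact lt_asymm hji (key i hi j hj u hu v hv hui hvj (lt_of_lt_of_le h hsv))
    have := Set.ncard_lt_ncard hsub (hfin _)
    omega
  · subst h
    exact ha i hi hui
  · exfalso
    have hdis : Disjoint {i | i ≤ n ∧ ∃ s' ∈ S, s' < s ∧ s' <+: G i} {i | i ≤ n ∧ s <+: G i} := by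
      rw [Set.disjoint_left]
      rintro j ⟨_, v, hv, hvs, hvj⟩ ⟨_, hsj⟩
      exact hvs.ne (huniq j v hv s hs hvj hsj)
    have hle := Set.ncard_le_ncard (s := {i | i ≤ n ∧ ∃ s' ∈ S, s' < s ∧ s' <+: G i} ∪ {i | i ≤ n ∧ s <+: G i})
      (t := {j | j ≤ n ∧ y j < y i}) (by
        rintro j (⟨hj, v, hv, hvs, hvj⟩ | ⟨hj, hsj⟩)
        · exact ⟨hj, key j hj i hi v hv u hu hvj hui (hvs.trans h)⟩
        · exact ⟨hj, key j hj i hi s hs u hu hsj hui h⟩) (hfin _)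
    rw [Set.ncard_union_eq hdis (hfin _) (hfin _)] at hle
    omega
end

section
/- Let S be a set of strings over Σ such that no element of S is a proper prefix of another element of S. Let x1, x2, x3 be strings with x1 ⪯ x2 ⪯ x3 in the (non-strict) lexicographic order. If some s ∈ S is a prefix of both x1 and x3, and some s2 ∈ S is a prefix of x2, then s2 = s. (Consequently, the strings having a fixed prefix s ∈ S form a contiguous block in lexicographic order among all strings possessing a prefix in S.) -/
theorem block_aux {σ : Type*} [LinearOrder σ] (s : List σ) : ∀ (a x b : List σ),
    (s ++ a = x ∨ List.Lex (· < ·) (s ++ a) x) →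
    (x = s ++ b ∨ List.Lex (· < ·) x (s ++ b)) → s <+: x := by
  induction s with
  | nil => intro a x b _ _; exact List.nil_prefix
  | cons c s ih =>
    intro a x b h1 h2
    cases x with
    | nil =>
      rcases h1 with h | h
      · simp at h
      · cases h
    | cons d y =>
      have e1 : c < d ∨ (c = d ∧ (s ++ a = y ∨ List.Lex (· < ·) (s ++ a) y)) := by
        rcases h1 with h | h
        · simp only [List.cons_append, List.cons.injEq] at h
          exact Or.inr ⟨h.1, Or.inl h.2⟩
        · rw [List.cons_append] at h
          cases h with
          | rel h => exact Or.inl h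
          | cons h => exact Or.inr ⟨rfl, Or.inr h⟩
      have e2 : d < c ∨ (d = c ∧ (y = s ++ b ∨ List.Lex (· < ·) y (s ++ b))) := by
        rcases h2 with h | h
        · simp only [List.cons_append, List.cons.injEq] at h
          exact Or.inr ⟨h.1, Or.inl h.2⟩
        · rw [List.cons_append] at h
          cases h with
          | rel h => exact Or.inl h
          | cons h => exact Or.inr ⟨rfl, Or.inr h⟩
      rcases e1 with e1 | ⟨rfl, e1⟩
      · rcases e2 with e2 | ⟨rfl, e2⟩
        · exact absurd e1 (lt_asymm e2)
        · exact absurd e1 (lt_irrefl _)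
      · rcases e2 with e2 | ⟨_, e2⟩
        · exact absurd e2 (lt_irrefl _)
        · exact (List.prefix_cons_inj c).2 (ih a y b e1 e2)

/-- strings with a fixed prefix in a prefix-free set `S` form a
contiguous block in lexicographic order among strings with a prefix in `S`. -/
theorem stmt_10 {σ : Type*} [LinearOrder σ] (S : Set (List σ))
    (hpf : ∀ u ∈ S, ∀ v ∈ S, u <+: v → u = v)
    (x1 x2 x3 : List σ)
    (h12 : x1 = x2 ∨ List.Lex (· < ·) x1 x2)
    (h23 : x2 = x3 ∨ List.Lex (· < ·) x2 x3)
    (s s2 : List σ) (hs : s ∈ S) (hs2 : s2 ∈ S)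
    (h1 : s <+: x1) (h3 : s <+: x3) (h2 : s2 <+: x2) :
    s2 = s := by
  obtain ⟨a, rfl⟩ := h1
  obtain ⟨b, rfl⟩ := h3
  have h := block_aux s a x2 b h12 h23
  rcases List.prefix_or_prefix_of_prefix h2 h with h | h
  · exact hpf _ hs2 _ hs h
  · exact (hpf _ hs _ hs2 h).symm
end

section
/- Fix w ≥ 1 and let D be a set of strings over a linearly ordered alphabet Σ, each of length strictly greater than w, such that no element of D is a proper prefix of another element of D. Let q and q' be nonempty overlap-consistent lists of elements of D. If glue_w(q) is strictly lexicographically smaller than glue_w(q') and glue_w(q) is not a prefix of glue_w(q'), then q strictly precedes q' in the lexicographic order on lists of strings induced by the lexicographic order on strings. -/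
/-- `glue w [e₁, …, e_r] = e₁ ++ drop w e₂ ++ ⋯ ++ drop w e_r`. -/
def glue {σ : Type*} (w : ℕ) : List (List σ) → List σ
  | [] => []
  | e :: rest => e ++ (rest.map (List.drop w)).flatten

/-- `L` is overlap-consistent: the first `w` characters of each element
coincide with the last `w` characters of the preceding one. -/
def OverlapConsistent {σ : Type*} (w : ℕ) (L : List (List σ)) : Prop :=
  List.Chain' (fun a b => b.take w = a.drop (a.length - w)) L

theorem aux_cancel {σ : Type*} [LinearOrder σ] (p a b : List σ)
    (h : List.Lex (· < ·) (p ++ a) (p ++ b)) : List.Lex (· < ·) a b := by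
  induction p with
  | nil => exact h
  | cons c p ih =>
    apply ih
    cases h with
    | cons h => exact h
    | rel h => exact absurd h (lt_irrefl _)

theorem aux_app {σ : Type*} [LinearOrder σ] (a b x y : List σ)
    (h : List.Lex (· < ·) a b) (hn : ¬ a <+: b) :
    List.Lex (· < ·) (a ++ x) (b ++ y) := by
  induction h with
  | nil => exact absurd (List.nil_prefix) hn
  | rel h => exact List.Lex.rel h
  | cons h ih =>
    refine List.Lex.cons (ih fun hp => hn ?_)
    exact (List.prefix_cons_inj _).2 hp

theorem aux_asymm {σ : Type*} [LinearOrder σ] (a b : List σ)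
    (h : List.Lex (· < ·) a b) (h2 : List.Lex (· < ·) b a) : False := by
  induction h with
  | nil => cases h2
  | rel h =>
    cases h2 with
    | rel h' => exact lt_asymm h h'
    | cons _ => exact lt_irrefl _ h
  | cons h ih =>
    cases h2 with
    | rel h' => exact lt_irrefl _ h'
    | cons h' => exact ih h'

theorem aux_tri {σ : Type*} [LinearOrder σ] (a b : List σ) :
    List.Lex (· < ·) a b ∨ a = b ∨ List.Lex (· < ·) b a := by
  induction a generalizing b with
  | nil => cases b with
    | nil => exact Or.inr (Or.inl rfl)
    | cons c b => exact Or.inl List.Lex.nil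
  | cons d a ih => cases b with
    | nil => exact Or.inr (Or.inr List.Lex.nil)
    | cons c b =>
      rcases lt_trichotomy d c with h | rfl | h
      · exact Or.inl (List.Lex.rel h)
      · rcases ih b with h | rfl | h
        · exact Or.inl (List.Lex.cons h)
        · exact Or.inr (Or.inl rfl)
        · exact Or.inr (Or.inr (List.Lex.cons h))
      · exact Or.inr (Or.inr (List.Lex.rel h))

theorem aux_glue {σ : Type*} (w : ℕ) (f : List σ) (s : List (List σ)) (hf : w < f.length) :
    glue w (f :: s) = f.take w ++ ((f :: s).map (List.drop w)).flatten := by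
  simp only [glue, List.map_cons, List.flatten_cons, ← List.append_assoc, List.take_append_drop]

/-- if the glued strings compare strictly and are not
prefix-related, then the parses compare in the induced lexicographic order. -/
theorem stmt_12 {σ : Type*} [LinearOrder σ] (w : ℕ) (hw : 1 ≤ w)
    (D : Set (List σ)) (hlen : ∀ d ∈ D, w < d.length)
    (hpf : ∀ u ∈ D, ∀ v ∈ D, u <+: v → u = v)
    (q q' : List (List σ)) (hq : q ≠ []) (hq' : q' ≠ [])
    (hqD : ∀ e ∈ q, e ∈ D) (hq'D : ∀ e ∈ q', e ∈ D)
    (hoc : OverlapConsistent w q) (hoc' : OverlapConsistent w q')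
    (hlex : List.Lex (· < ·) (glue w q) (glue w q'))
    (hnp : ¬ glue w q <+: glue w q') :
    List.Lex (fun a b => List.Lex (· < ·) a b) q q' := by
  induction q generalizing q' with
  | nil => exact absurd rfl hq
  | cons e t ih =>
    cases q' with
    | nil => exact absurd rfl hq'
    | cons e' t' =>
      rcases aux_tri e e' with h | rfl | h
      · exact List.Lex.rel h
      · refine List.Lex.cons ?_
        cases t with
        | nil => exact absurd (by simp [glue]) hnp
        | cons f s =>
          have h1 := aux_cancel _ _ _ hlex
          cases t' with
          | nil => exact absurd h1 List.not_lex_nil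
          | cons f' s' =>
            unfold OverlapConsistent at hoc hoc'
            have k1 := (List.isChain_cons_cons.1 hoc)
            have k2 := (List.isChain_cons_cons.1 hoc')
            have g1 := aux_glue w f s (hlen _ (hqD _ (by simp)))
            have g2 := aux_glue w f' s' (hlen _ (hq'D _ (by simp)))
            rw [k1.1] at g1
            rw [k2.1] at g2
            refine ih (f' :: s') (by simp) (by simp)
              (fun x hx => hqD x (List.mem_cons_of_mem _ hx))
              (fun x hx => hq'D x (List.mem_cons_of_mem _ hx)) k1.2 k2.2 ?_ ?_
            · rw [g1, g2]
              exact List.Lex.append_left _ h1 _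
            · rw [g1, g2, List.prefix_append_right_inj]
              intro hp
              exact hnp ((List.prefix_append_right_inj _).2 hp)
      · exfalso
        refine aux_asymm _ _ hlex (aux_app _ _ _ _ h fun hp => ?_)
        have := hpf _ (hq'D _ (by simp)) _ (hqD _ (by simp)) hp
        subst this
        exact aux_asymm _ _ h h
end
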